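/- arXiv:1803.04727 — 2 statements merged into one kernel-verified Lean document; each statement's English description precedes it below -/
import Mathlib

section
/- Let Y be a real Banach space. Every bounded linear operator T : ℓ∞⁴ → Y satisfies ‖T‖ = max( max{‖T(v_i)‖ : 1 ≤ i ≤ 4}, max{‖T(v_{i₁} − v_{i₂} + v_{i₃})‖ : 1 ≤ i₁ < i₂ < i₃ ≤ 4} ). Consequently, ‖T‖ ≤ 1 if and only if (T(v₁), T(v₂), T(v₃), T(v₄)) ∈ M_Y^4, so the map T ↦ (T(v_i))_{i≤4} is a bijection from the closed unit ball of L(ℓ∞⁴, Y) onto M_Y^4. -/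
/-- `M_Y^4`: quadruples `(y₁,y₂,y₃,y₄)` in the closed unit ball of `Y` such that
`‖y_{i₁} − y_{i₂} + y_{i₃}‖ ≤ 1` for all `i₁ < i₂ < i₃`. -/
def MY4 {Y : Type*} [NormedAddCommGroup Y] (y : Fin 4 → Y) : Prop :=
  (∀ i, ‖y i‖ ≤ 1) ∧
    ∀ i j k : Fin 4, i < j → j < k → ‖y i - y j + y k‖ ≤ 1

/-- The vectors `v₁, v₂, v₃, v₄` (0-indexed) in `ℓ∞⁴ = (Fin 4 → ℝ, sup norm)`. -/
def v4 : Fin 4 → (Fin 4 → ℝ) :=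
  ![![1, 1, 1, 1], ![1, -1, 1, 1], ![1, -1, -1, 1], ![1, -1, -1, -1]]

/-- A vector of `ℓ∞(ι)` all of whose coordinates are `1` or `-1`. -/
def IsSignVector {ι : Type*} (w : ι → ℝ) : Prop := ∀ i, w i = -1 ∨ w i = 1

theorem IsSignVector.norm_le_one {ι : Type*} [Fintype ι] {w : ι → ℝ} (hw : IsSignVector w) :
    ‖w‖ ≤ 1 := by
  refine (pi_norm_le_iff_of_nonneg zero_le_one).2 fun i => ?_
  rcases hw i with h | h <;> simp [h]

theorem setOf_isSignVector {ι : Type*} :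
    {w : ι → ℝ | IsSignVector w} = Set.univ.pi fun _ => {-1, 1} := by
  ext w
  simp [IsSignVector]

theorem closedBall_subset_convexHull_isSignVector {ι : Type*} [Fintype ι] :
    Metric.closedBall (0 : ι → ℝ) 1 ⊆ convexHull ℝ {w | IsSignVector w} := by
  intro x hx
  rw [setOf_isSignVector, convexHull_pi]
  intro i _
  rw [convexHull_pair, segment_eq_Icc (by norm_num)]
  exact abs_le.1 ((norm_le_pi_norm x i).trans (mem_closedBall_zero_iff.1 hx))

/-- An operator on a finite-dimensional `ℓ∞` space attains its norm at a sign vector. -/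
theorem exists_isSignVector_norm_apply_eq {ι Y : Type*} [Fintype ι] [NormedAddCommGroup Y]
    [NormedSpace ℝ Y] (T : (ι → ℝ) →L[ℝ] Y) : ∃ w, IsSignVector w ∧ ‖T w‖ = ‖T‖ := by
  have hfin : {w : ι → ℝ | IsSignVector w}.Finite := by
    rw [setOf_isSignVector]
    exact Set.Finite.pi fun _ => Set.toFinite _
  obtain ⟨w, hw, hmax⟩ := Set.exists_max_image _ (fun w => ‖T w‖) hfin
    ⟨fun _ => 1, fun _ => Or.inr rfl⟩
  refine ⟨w, hw, le_antisymm ?_ ?_⟩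
  · simpa using T.le_of_opNorm_le_of_le le_rfl hw.norm_le_one
  · refine ContinuousLinearMap.opNorm_le_of_unit_norm (norm_nonneg _) fun x hx => ?_
    have hconv : ConvexOn ℝ Set.univ fun x => ‖T x‖ :=
      convexOn_univ_norm.comp_linearMap T.toLinearMap
    obtain ⟨z, hz, hle⟩ := hconv.exists_ge_of_mem_convexHull (Set.subset_univ _)
      (closedBall_subset_convexHull_isSignVector (mem_closedBall_zero_iff.2 hx.le))
    exact hle.trans (hmax z hz)

theorem isSignVector_v4 (i : Fin 4) : IsSignVector (v4 i) := by
  intro j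
  fin_cases i <;> fin_cases j <;> simp [v4]

theorem isSignVector_v4_sub_add {i j k : Fin 4} (hij : i < j) (hjk : j < k) :
    IsSignVector (v4 i - v4 j + v4 k) := by
  intro l
  fin_cases i <;> fin_cases j <;> fin_cases k <;> first
    | exact absurd hij (by decide)
    | exact absurd hjk (by decide)
    | fin_cases l <;> simp [v4]

/-- Up to sign, the sign vectors of `ℓ∞⁴` are the `v4 i` and the `v4 i - v4 j + v4 k` with
`i < j < k`. -/
theorem IsSignVector.eq_v4_or_eq_sub_add {w : Fin 4 → ℝ} (hw : IsSignVector w) :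
    (∃ i, w = v4 i ∨ w = -v4 i) ∨ ∃ i j k, i < j ∧ j < k ∧
      (w = v4 i - v4 j + v4 k ∨ w = -(v4 i - v4 j + v4 k)) := by
  have hext : w = ![w 0, w 1, w 2, w 3] := by
    ext i
    fin_cases i <;> rfl
  rw [hext]
  rcases hw 0 with h0 | h0 <;> rcases hw 1 with h1 | h1 <;> rcases hw 2 with h2 | h2 <;>
    rcases hw 3 with h3 | h3 <;> rw [h0, h1, h2, h3] <;> first
    | (refine Or.inl ⟨0, ?_⟩; simp [v4]; done)
    | (refine Or.inl ⟨1, ?_⟩; simp [v4]; done)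
    | (refine Or.inl ⟨2, ?_⟩; simp [v4]; done)
    | (refine Or.inl ⟨3, ?_⟩; simp [v4]; done)
    | (refine Or.inr ⟨0, 1, 2, by decide, by decide, ?_⟩; simp [v4]; done)
    | (refine Or.inr ⟨0, 1, 3, by decide, by decide, ?_⟩; simp [v4]; done)
    | (refine Or.inr ⟨0, 2, 3, by decide, by decide, ?_⟩; simp [v4]; done)
    | (refine Or.inr ⟨1, 2, 3, by decide, by decide, ?_⟩; simp [v4])

theorem isGreatest_opNorm_v4 {Y : Type*} [NormedAddCommGroup Y] [NormedSpace ℝ Y]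
    (T : (Fin 4 → ℝ) →L[ℝ] Y) :
    IsGreatest ({r : ℝ | ∃ i : Fin 4, r = ‖T (v4 i)‖} ∪
      {r : ℝ | ∃ i j k : Fin 4, i < j ∧ j < k ∧ r = ‖T (v4 i - v4 j + v4 k)‖}) ‖T‖ := by
  constructor
  · obtain ⟨w, hw, hT⟩ := exists_isSignVector_norm_apply_eq T
    rw [← hT]
    rcases hw.eq_v4_or_eq_sub_add with ⟨i, rfl | rfl⟩ | ⟨i, j, k, hij, hjk, rfl | rfl⟩
    · exact Or.inl ⟨i, rfl⟩
    · exact Or.inl ⟨i, by rw [map_neg, norm_neg]⟩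
    · exact Or.inr ⟨i, j, k, hij, hjk, rfl⟩
    · exact Or.inr ⟨i, j, k, hij, hjk, by rw [map_neg, norm_neg]⟩
  · rintro r (⟨i, rfl⟩ | ⟨i, j, k, hij, hjk, rfl⟩)
    · simpa using T.le_of_opNorm_le_of_le le_rfl (isSignVector_v4 i).norm_le_one
    · simpa using T.le_of_opNorm_le_of_le le_rfl (isSignVector_v4_sub_add hij hjk).norm_le_one

theorem opNorm_le_one_iff_MY4 {Y : Type*} [NormedAddCommGroup Y] [NormedSpace ℝ Y]
    (T : (Fin 4 → ℝ) →L[ℝ] Y) : ‖T‖ ≤ 1 ↔ MY4 fun i => T (v4 i) := by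
  rw [isLUB_le_iff (isGreatest_opNorm_v4 T).isLUB]
  constructor
  · intro h
    refine ⟨fun i => h (Or.inl ⟨i, rfl⟩), fun i j k hij hjk => ?_⟩
    rw [← map_sub, ← map_add]
    exact h (Or.inr ⟨i, j, k, hij, hjk, rfl⟩)
  · rintro ⟨h₁, h₂⟩ r (⟨i, rfl⟩ | ⟨i, j, k, hij, hjk, rfl⟩)
    · exact h₁ i
    · simpa using h₂ i j k hij hjk

theorem eq_sum_smul_v4 (x : Fin 4 → ℝ) :
    x = ((x 0 + x 1) / 2) • v4 0 + ((x 2 - x 1) / 2) • v4 1 + ((x 3 - x 2) / 2) • v4 2 +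
      ((x 0 - x 3) / 2) • v4 3 := by
  ext i
  fin_cases i <;> simp [v4] <;> ring

theorem exists_clm_apply_v4_eq {Y : Type*} [NormedAddCommGroup Y] [NormedSpace ℝ Y]
    (y : Fin 4 → Y) : ∃ T : (Fin 4 → ℝ) →L[ℝ] Y, ∀ i, T (v4 i) = y i := by
  let π (i : Fin 4) : (Fin 4 → ℝ) →L[ℝ] ℝ := ContinuousLinearMap.proj i
  refine ⟨((2⁻¹ : ℝ) • (π 0 + π 1)).smulRight (y 0) + ((2⁻¹ : ℝ) • (π 2 - π 1)).smulRight (y 1) +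
    ((2⁻¹ : ℝ) • (π 3 - π 2)).smulRight (y 2) + ((2⁻¹ : ℝ) • (π 0 - π 3)).smulRight (y 3),
    fun i => ?_⟩
  fin_cases i <;> simp [v4, π] <;> norm_num

theorem clm_ext_v4 {Y : Type*} [NormedAddCommGroup Y] [NormedSpace ℝ Y]
    {S T : (Fin 4 → ℝ) →L[ℝ] Y} (h : ∀ i, S (v4 i) = T (v4 i)) : S = T := by
  ext1 x
  rw [eq_sum_smul_v4 x]
  simp only [map_add, map_smul, h]

/-- Every bounded linear operator `T : ℓ∞⁴ → Y` satisfies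
`‖T‖ = max(max_i ‖T v_i‖, max_{i<j<k} ‖T(v_i − v_j + v_k)‖)`; consequently `‖T‖ ≤ 1`
iff `(T v₁, …, T v₄) ∈ M_Y^4`, and `T ↦ (T v_i)` is a bijection from the closed unit
ball of `L(ℓ∞⁴, Y)` onto `M_Y^4`. -/
theorem stmt8 (Y : Type*) [NormedAddCommGroup Y] [NormedSpace ℝ Y] [CompleteSpace Y] :
    (∀ T : (Fin 4 → ℝ) →L[ℝ] Y,
      IsGreatest ({r : ℝ | ∃ i : Fin 4, r = ‖T (v4 i)‖} ∪
        {r : ℝ | ∃ i j k : Fin 4, i < j ∧ j < k ∧ r = ‖T (v4 i - v4 j + v4 k)‖}) ‖T‖) ∧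
    (∀ T : (Fin 4 → ℝ) →L[ℝ] Y, ‖T‖ ≤ 1 ↔ MY4 (fun i => T (v4 i))) ∧
    (∀ y : Fin 4 → Y, MY4 y →
      ∃! T : (Fin 4 → ℝ) →L[ℝ] Y, ‖T‖ ≤ 1 ∧ ∀ i, T (v4 i) = y i) := by
  refine ⟨isGreatest_opNorm_v4, opNorm_le_one_iff_MY4, fun y hy => ?_⟩
  obtain ⟨T, hT⟩ := exists_clm_apply_v4_eq y
  refine ⟨T, ⟨(opNorm_le_one_iff_MY4 T).2 ?_, hT⟩, fun S hS => ?_⟩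
  · simpa only [hT] using hy
  · exact clm_ext_v4 fun i => (hS.2 i).trans (hT i).symm
end

section
/- There exists a single function γ : (0,1) → (0,1) with 0 < γ(ε) < ε such that for every natural number n ≥ 1 the space ℓ₁ⁿ (ℝⁿ with the norm ‖x‖ = ∑_{k=1}^n |x(k)|) has the approximate hyperplane sum property for ℓ∞⁴ with this same function γ. -/
/-- `Y` has the approximate hyperplane sum property for `ℓ∞⁴` with the function `γ`. -/
def AHSpL4With (Y : Type*) [NormedAddCommGroup Y] [NormedSpace ℝ Y] (γ : ℝ → ℝ) : Prop :=
  ∀ ε : ℝ, 0 < ε → ε < 1 →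
    (0 < γ ε ∧ γ ε < ε) ∧
    ∀ y : Fin 4 → Y, MY4 y →
      ∀ A : Finset (Fin 4), A.Nonempty →
        ∀ f : Y →L[ℝ] ℝ, ‖f‖ = 1 →
          (∀ i ∈ A, 1 - γ ε < f (y i)) →
          ∃ z : Fin 4 → Y, MY4 z ∧ (∀ i, ‖z i - y i‖ < ε) ∧
            ‖∑ i ∈ A, z i‖ = (A.card : ℝ)

open Finset

/-- Finitely many linear functionals with trivial common kernel admit finitely many generators such
that every vector is a nonnegative combination of them without cancellation in any functional. -/
theorem exists_conformal_generators {V J : Type*} [AddCommGroup V] [Module ℝ V] [Finite J]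
    (l : J → V →ₗ[ℝ] ℝ) (hl : ∀ x, (∀ j, l j x = 0) → x = 0) :
    ∃ (N : ℕ) (r : Fin N → V), (∀ s, r s ≠ 0) ∧ ∀ x, ∃ c : Fin N → ℝ,
      (∀ s, 0 ≤ c s) ∧ x = ∑ s, c s • r s ∧ ∀ j, |l j x| = ∑ s, c s * |l j (r s)| := by
  classical
  have := Fintype.ofFinite J
  let T := {σ : J → SignType // ∃ x, x ≠ 0 ∧ ∀ j, SignType.sign (l j x) = σ j}
  obtain ⟨N, ⟨e⟩⟩ := Finite.exists_equiv_fin T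
  choose v hv0 hv using fun σ : T => σ.2
  refine ⟨N, fun s => v (e.symm s), fun s => hv0 _, fun x => ?_⟩
  induction h : (univ.filter fun j => l j x ≠ 0).card using Nat.strong_induction_on
    generalizing x with
  | _ m ih =>
  by_cases hx : x = 0
  · exact ⟨0, by simp, by simp [hx], by simp [hx]⟩
  let σ : T := ⟨fun j => SignType.sign (l j x), x, hx, fun _ => rfl⟩
  have hr : ∀ j, SignType.sign (l j (v σ)) = SignType.sign (l j x) := hv σ
  have hne : (univ.filter fun j => l j x ≠ 0).Nonempty := by
    by_contra hcon
    rw [Finset.not_nonempty_iff_eq_empty, Finset.filter_eq_empty_iff] at hcon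
    exact hx (hl x fun j => by simpa using hcon (mem_univ j))
  obtain ⟨i, hi, hmin⟩ := Finset.exists_min_image _ (fun j => |l j x| / |l j (v σ)|) hne
  have hzero : ∀ j, l j (v σ) = 0 ↔ l j x = 0 := fun j => by
    rw [← sign_eq_zero_iff, hr, sign_eq_zero_iff]
  set t := |l i x| / |l i (v σ)| with ht
  have ht0 : 0 ≤ t := by positivity
  simp only [mem_filter, mem_univ, true_and] at hi hmin
  have hit : |l i x| = t * |l i (v σ)| := by
    have : |l i (v σ)| ≠ 0 := by simpa [hzero] using hi
    rw [ht]; field_simp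
  have hle : ∀ j, t * |l j (v σ)| ≤ |l j x| := by
    intro j
    by_cases hj : l j x = 0
    · simp [hj, (hzero j).2 hj]
    · have : 0 < |l j (v σ)| := by simpa [hzero] using hj
      exact (le_div_iff₀ this).1 (hmin j hj)
  have habs : ∀ j, |l j (x - t • v σ)| = |l j x| - t * |l j (v σ)| := by
    intro j
    have h1 := hle j
    have h2 := hr j
    rw [map_sub, map_smul, smul_eq_mul]
    rcases lt_trichotomy (l j x) 0 with hj | hj | hj
    · rw [sign_neg hj, sign_eq_neg_one_iff] at h2
      rw [abs_of_neg hj, abs_of_neg h2] at *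
      rw [abs_of_nonpos (by linarith)]; ring
    · simp [hj, (hzero j).2 hj]
    · rw [sign_pos hj, sign_eq_one_iff] at h2
      rw [abs_of_pos hj, abs_of_pos h2] at *
      rw [abs_of_nonneg (by linarith)]
  have hcard : (univ.filter fun j => l j (x - t • v σ) ≠ 0).card < m := by
    rw [← h]
    refine Finset.card_lt_card ⟨fun j => ?_, fun hsub => ?_⟩
    · simp only [mem_filter, mem_univ, true_and]
      intro hj h0
      exact hj (by rw [← abs_eq_zero, habs, h0, (hzero j).2 h0]; simp)
    · have := hsub (mem_filter.2 ⟨mem_univ i, hi⟩)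
      rw [mem_filter, ← abs_pos, habs, hit] at this
      simp at this
  obtain ⟨c, hc0, hcx, hca⟩ := ih _ hcard _ rfl
  refine ⟨c + Pi.single (e σ) t, fun s => ?_, ?_, fun j => ?_⟩
  · exact add_nonneg (hc0 s) ((Pi.single_nonneg.2 ht0 : (0 : Fin N → ℝ) ≤ _) s)
  · simp [add_smul, sum_add_distrib, ← hcx, Pi.single_apply, ite_smul]
  · have := habs j
    rw [hca] at this
    simp [add_mul, sum_add_distrib, Pi.single_apply, ite_mul, this]

/-- On a compact set, near-solutions of `g ≤ 0` are close to solutions. -/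
theorem IsCompact.exists_near_solution {X : Type*} [PseudoMetricSpace X] {K : Set X}
    (hK : IsCompact K) {g : X → ℝ} (hg : Continuous g) {ε : ℝ} (hε : 0 < ε) :
    ∃ δ > 0, ∀ w ∈ K, g w < δ → ∃ w' ∈ K, g w' ≤ 0 ∧ dist w' w < ε := by
  have hopen : IsOpen (⋃ w' ∈ {w' ∈ K | g w' ≤ 0}, Metric.ball w' ε) :=
    isOpen_biUnion fun _ _ => Metric.isOpen_ball
  have hK' := hK.diff hopen
  have key : ∀ δ, (∀ w ∈ K \ ⋃ w' ∈ {w' ∈ K | g w' ≤ 0}, Metric.ball w' ε, δ ≤ g w) →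
      ∀ w ∈ K, g w < δ → ∃ w' ∈ K, g w' ≤ 0 ∧ dist w' w < ε := by
    intro δ hδ w hw hgw
    by_contra! hcon
    refine absurd (hδ w ⟨hw, ?_⟩) (not_le.2 hgw)
    simp only [Set.mem_iUnion, not_exists, Metric.mem_ball, not_lt]
    intro w' hw'
    rw [dist_comm]
    exact hcon w' hw'.1 hw'.2
  rcases (K \ ⋃ w' ∈ {w' ∈ K | g w' ≤ 0}, Metric.ball w' ε).eq_empty_or_nonempty with he | hne
  · exact ⟨1, one_pos, key 1 fun w hw => absurd (he ▸ hw) (Set.notMem_empty w)⟩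
  · obtain ⟨w₀, hw₀, hmin⟩ := hK'.exists_isMinOn hne hg.continuousOn
    refine ⟨g w₀, ?_, key _ fun w hw => hmin hw⟩
    by_contra! hcon
    exact hw₀.2 (Set.mem_biUnion (x := w₀) ⟨hw₀.1, hcon⟩ (Metric.mem_ball_self hε))

/-- A nonnegative family can be changed to a nonnegative family with prescribed sum, at `ℓ₁` cost
the change of the sum. -/
theorem exists_nonneg_sum_eq {ι : Type*} [Fintype ι] [Nonempty ι] (c : ι → ℝ) (hc : ∀ k, 0 ≤ c k)
    {w : ℝ} (hw : 0 ≤ w) :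
    ∃ c' : ι → ℝ, (∀ k, 0 ≤ c' k) ∧ ∑ k, c' k = w ∧ ∑ k, |c' k - c k| = |w - ∑ k, c k| := by
  classical
  by_cases h : ∑ k, c k = 0
  · have h0 : ∀ k, c k = 0 := fun k =>
      (Finset.sum_eq_zero_iff_of_nonneg fun i _ => hc i).1 h k (mem_univ k)
    obtain ⟨k₀⟩ := ‹Nonempty ι›
    have hs : (0 : ι → ℝ) ≤ Pi.single k₀ w := Pi.single_nonneg.2 hw
    refine ⟨Pi.single k₀ w, hs, by simp, ?_⟩
    simp only [h0, sub_zero, sum_const_zero, abs_of_nonneg hw]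
    rw [sum_congr rfl fun k _ => abs_of_nonneg (hs k)]
    simp
  · have hS : 0 ≤ ∑ k, c k := sum_nonneg fun k _ => hc k
    refine ⟨fun k => c k * (w / ∑ k, c k), fun k => mul_nonneg (hc k) (div_nonneg hw hS), ?_, ?_⟩
    · rw [← sum_mul]; field_simp
    · have : ∀ k, |c k * (w / ∑ k, c k) - c k| = c k * |w / ∑ k, c k - 1| := fun k => by
        rw [← mul_sub_one, abs_mul, abs_of_nonneg (hc k)]
      simp only [this]
      rw [← sum_mul]
      nth_rewrite 1 [← abs_of_nonneg hS]
      rw [← abs_mul]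
      congr 1
      field_simp

/-- Quantitative correction of finite families in `ℝ^ι` subject to `ℓ₁` constraints, with a modulus
that does not depend on the size of the family. -/
theorem exists_correction {I J : Type*} [Fintype I] [Finite J]
    (l : J → (I → ℝ) →ₗ[ℝ] ℝ) (hl : ∀ x, (∀ j, l j x = 0) → x = 0) (φ : (I → ℝ) →ₗ[ℝ] ℝ) (a : ℝ)
    {ε : ℝ} (hε : 0 < ε) :
    ∃ δ > 0, ∀ {ι : Type} [Fintype ι] [Nonempty ι] (x : ι → I → ℝ),
      (∀ j, ∑ k, |l j (x k)| ≤ 1) → a - δ < ∑ k, φ (x k) →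
      ∃ z : ι → I → ℝ, (∀ j, ∑ k, |l j (z k)| ≤ 1) ∧ a ≤ ∑ k, φ (z k) ∧
        ∀ i, ∑ k, |z k i - x k i| < ε := by
  obtain ⟨N, r, hr0, hr⟩ := exists_conformal_generators l hl
  let K : Set (Fin N → ℝ) := {w | (∀ s, 0 ≤ w s) ∧ ∀ j, ∑ s, w s * |l j (r s)| ≤ 1}
  have hKc : IsCompact K := by
    have hex : ∀ s, ∃ j, l j (r s) ≠ 0 := fun s => by
      by_contra! hcon
      exact hr0 s (hl _ hcon)
    choose j hj using hex
    refine IsCompact.of_isClosed_subset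
      (isCompact_univ_pi fun s => isCompact_Icc (a := (0 : ℝ)) (b := 1 / |l (j s) (r s)|)) ?_ ?_
    · simp only [K, Set.ofPred_and, Set.ofPred_forall]
      refine (isClosed_iInter fun s => isClosed_le (by fun_prop) (by fun_prop)).inter
        (isClosed_iInter fun j => isClosed_le (by fun_prop) (by fun_prop))
    · rintro w ⟨h0, h1⟩ s -
      refine ⟨h0 s, (le_div_iff₀ (abs_pos.2 (hj s))).2 ((h1 (j s)).trans' ?_)⟩
      exact single_le_sum (f := fun s' => w s' * |l (j s) (r s')|)
        (fun s' _ => mul_nonneg (h0 s') (abs_nonneg _)) (mem_univ s)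
  let g : (Fin N → ℝ) → ℝ := fun w => a - ∑ s, w s * φ (r s)
  have hg : Continuous g := by fun_prop
  set C : ℝ := ∑ s, ‖r s‖ with hC
  have hC0 : 0 ≤ C := sum_nonneg fun s _ => norm_nonneg _
  obtain ⟨δ, hδ, H⟩ := hKc.exists_near_solution hg (ε := ε / (1 + C)) (by positivity)
  refine ⟨δ, hδ, fun {ι} _ _ x hx1 hx2 => ?_⟩
  choose c hc0 hcx hca using fun k => hr (x k)
  obtain ⟨w', ⟨hwn, hwl⟩, hgw', hdist⟩ := H (fun s => ∑ k, c k s)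
    ⟨fun s => sum_nonneg fun k _ => hc0 k s, fun j => by
      simp only [sum_mul]
      rw [sum_comm]
      simpa only [hca] using hx1 j⟩ (by
      have : ∑ k, φ (x k) = ∑ s, (∑ k, c k s) * φ (r s) := by
        simp only [sum_mul]
        rw [sum_comm]
        refine sum_congr rfl fun k _ => ?_
        conv_lhs => rw [hcx k]
        simp
      simp only [g]
      linarith)
  choose c' hcn hcs hcd using fun s =>
    exists_nonneg_sum_eq (fun k => c k s) (fun k => hc0 k s) (hwn s)
  refine ⟨fun k => ∑ s, c' s k • r s, fun j => ?_, ?_, fun i => ?_⟩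
  · refine le_trans ?_ (hwl j)
    simp only [← hcs, sum_mul]
    rw [sum_comm]
    refine sum_le_sum fun k _ => ?_
    rw [map_sum]
    refine (abs_sum_le_sum_abs _ _).trans (sum_le_sum fun s _ => ?_)
    rw [map_smul, smul_eq_mul, abs_mul, abs_of_nonneg (hcn s k)]
  · have : ∑ k, φ (∑ s, c' s k • r s) = ∑ s, w' s * φ (r s) := by
      simp only [← hcs, sum_mul, map_sum, map_smul, smul_eq_mul]
      rw [sum_comm]
    rw [this]
    simp only [g] at hgw'
    linarith
  · calc ∑ k, |(∑ s, c' s k • r s) i - x k i|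
        ≤ ∑ k, ∑ s, |c' s k - c k s| * ‖r s‖ := by
          refine sum_le_sum fun k _ => ?_
          conv_lhs => rw [hcx k]
          simp only [Finset.sum_apply, Pi.smul_apply, smul_eq_mul, ← sum_sub_distrib, ← sub_mul]
          refine (abs_sum_le_sum_abs _ _).trans (sum_le_sum fun s _ => ?_)
          rw [abs_mul]
          exact mul_le_mul_of_nonneg_left (norm_le_pi_norm (r s) i) (abs_nonneg _)
      _ = ∑ s, |w' s - ∑ k, c k s| * ‖r s‖ := by
          rw [sum_comm]
          simp only [← sum_mul, hcd]
      _ ≤ ∑ s, ε / (1 + C) * ‖r s‖ := by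
          refine sum_le_sum fun s _ => mul_le_mul_of_nonneg_right ?_ (norm_nonneg _)
          exact (dist_le_pi_dist w' (fun s => ∑ k, c k s) s).trans hdist.le
      _ = ε * (C / (1 + C)) := by rw [← mul_sum, ← hC]; ring
      _ < ε := mul_lt_of_lt_one_right hε ((div_lt_one (by linarith)).2 (by linarith))

/-- The functionals on `ℝ⁴` whose `ℓ₁` norms are constrained in `MY4`. -/
def my4Functional :
    Fin 4 ⊕ {p : Fin 4 × Fin 4 × Fin 4 // p.1 < p.2.1 ∧ p.2.1 < p.2.2} → (Fin 4 → ℝ) →ₗ[ℝ] ℝ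
  | .inl i => LinearMap.proj (R := ℝ) (φ := fun _ => ℝ) i
  | .inr p => LinearMap.proj (R := ℝ) (φ := fun _ => ℝ) p.1.1 -
      LinearMap.proj (R := ℝ) (φ := fun _ => ℝ) p.1.2.1 +
      LinearMap.proj (R := ℝ) (φ := fun _ => ℝ) p.1.2.2

theorem my4_iff_sum_abs_my4Functional_le {n : ℕ} (y : Fin 4 → PiLp 1 (fun _ : Fin n => ℝ)) :
    MY4 y ↔ ∀ j, ∑ k, |my4Functional j (fun i => y i k)| ≤ 1 := by
  simp [MY4, my4Functional, PiLp.norm_eq_of_L1, Sum.forall]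

theorem MY4.norm_sum_le {Y : Type*} [NormedAddCommGroup Y] {y : Fin 4 → Y} (hy : MY4 y)
    (A : Finset (Fin 4)) : ‖∑ i ∈ A, y i‖ ≤ A.card := by
  simpa using norm_sum_le_of_le A fun i _ => hy.1 i

/-- The uniform correction statement in `ℓ₁ⁿ` for one `ε` and one index set. -/
theorem exists_my4_correction (A : Finset (Fin 4)) {ε : ℝ} (hε : 0 < ε) :
    ∃ δ > 0, ∀ n : ℕ, 1 ≤ n → ∀ y : Fin 4 → PiLp 1 (fun _ : Fin n => ℝ), MY4 y →
      A.card - δ < ‖∑ i ∈ A, y i‖ →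
      ∃ z : Fin 4 → PiLp 1 (fun _ : Fin n => ℝ), MY4 z ∧ (∀ i, ‖z i - y i‖ < ε) ∧
        ‖∑ i ∈ A, z i‖ = (A.card : ℝ) := by
  obtain ⟨δ, hδ, H⟩ := exists_correction my4Functional
    (fun x hx => funext fun i => hx (.inl i)) (∑ i ∈ A, LinearMap.proj i) A.card hε
  refine ⟨δ, hδ, fun n hn y hy hA => ?_⟩
  have : Nonempty (Fin n) := ⟨⟨0, hn⟩⟩
  let u : Fin n → ℝ := fun k => if 0 ≤ ∑ i ∈ A, y i k then 1 else -1
  have hu : ∀ k, |u k| = 1 := fun k => by simp only [u]; split_ifs <;> simp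
  have huu : ∀ k, u k * u k = 1 := fun k => by rw [← abs_mul_abs_self, hu, one_mul]
  have huy : ∀ k, u k * ∑ i ∈ A, y i k = |∑ i ∈ A, y i k| := fun k => by
    simp only [u]
    split_ifs with h
    · rw [abs_of_nonneg h, one_mul]
    · rw [abs_of_neg (not_le.1 h), neg_one_mul]
  obtain ⟨z, hz1, hz2, hz3⟩ := H (fun k => u k • fun i => y i k)
    (fun j => by
      simpa [abs_mul, hu] using (my4_iff_sum_abs_my4Functional_le y).1 hy j)
    (by
      simpa [PiLp.norm_eq_of_L1, ← mul_sum, huy] using hA)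
  let z' : Fin 4 → PiLp 1 (fun _ : Fin n => ℝ) := fun i => WithLp.toLp 1 fun k => u k * z k i
  have hz' : MY4 z' := by
    rw [my4_iff_sum_abs_my4Functional_le]
    intro j
    have h : ∀ k, (fun i => z' i k) = u k • z k := fun k => rfl
    simpa [h, abs_mul, hu] using hz1 j
  refine ⟨z', hz', fun i => ?_, (hz'.norm_sum_le A).antisymm ?_⟩
  · refine lt_of_eq_of_lt ?_ (hz3 i)
    rw [PiLp.norm_eq_of_L1]
    refine sum_congr rfl fun k _ => ?_
    rw [Real.norm_eq_abs, ← one_mul |z k i - _|, ← hu k, ← abs_mul]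
    congr 1
    simp only [z', PiLp.sub_apply, Pi.smul_apply, smul_eq_mul]
    linear_combination y i k * huu k
  · refine hz2.trans ?_
    rw [PiLp.norm_eq_of_L1]
    refine sum_le_sum fun k _ => ?_
    have h : (∑ i ∈ A, z' i) k = u k * ∑ i ∈ A, z k i := by simp [z', mul_sum]
    rw [h, Real.norm_eq_abs, abs_mul, hu, one_mul]
    simpa using le_abs_self (∑ i ∈ A, z k i)

/-- There is a single function `γ` such that every `ℓ₁ⁿ` (`ℝⁿ` with the norm
`‖x‖ = ∑ |x(k)|`, here `PiLp 1`) has the AHSp-`ℓ∞⁴` with this same function `γ`. -/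
theorem stmt17 :
    ∃ γ : ℝ → ℝ, ∀ n : ℕ, 1 ≤ n →
      AHSpL4With (PiLp 1 (fun _ : Fin n => ℝ)) γ := by
  choose! δ hδ H using fun (A : Finset (Fin 4)) (ε : ℝ) (hε : 0 < ε) => exists_my4_correction A hε
  have hγ : ∀ ε : ℝ, ∃ γ : ℝ, 0 < ε → 0 < γ ∧ γ < ε ∧ ∀ A, 4 * γ ≤ δ A ε := by
    intro ε
    by_cases hε : 0 < ε
    · obtain ⟨A, hA⟩ := Finite.exists_min fun A => δ A ε
      have hpos := hδ A ε hε
      refine ⟨min (ε / 2) (δ A ε / 4), fun _ => ⟨by positivity, ?_, fun B => ?_⟩⟩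
      · exact (min_le_left _ _).trans_lt (half_lt_self hε)
      · linarith [min_le_right (ε / 2) (δ A ε / 4), hA B]
    · exact ⟨0, fun h => absurd h hε⟩
  choose γ hγ using hγ
  refine ⟨γ, fun n hn ε hε _ => ?_⟩
  obtain ⟨h0, h1, h2⟩ := hγ ε hε
  refine ⟨⟨h0, h1⟩, fun y hy A hA f hf hfy => H A ε hε n hn y hy ?_⟩
  have hcard : (A.card : ℝ) ≤ 4 := by exact_mod_cast card_finset_fin_le A
  calc (A.card : ℝ) - δ A ε ≤ ∑ i ∈ A, (1 - γ ε) := by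
        rw [sum_const, nsmul_eq_mul]
        nlinarith [h2 A]
    _ < ∑ i ∈ A, f (y i) := sum_lt_sum_of_nonempty hA hfy
    _ = f (∑ i ∈ A, y i) := (map_sum f _ _).symm
    _ ≤ ‖f (∑ i ∈ A, y i)‖ := Real.le_norm_self _
    _ ≤ ‖∑ i ∈ A, y i‖ := by simpa [hf] using f.le_opNorm (∑ i ∈ A, y i)
end
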